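/- arXiv:2006.07056 — 6 statements merged into one kernel-verified Lean document; each statement's English description precedes it below -/
import Mathlib

section
/- For every integer d ≥ 1 there exists a constant B₃ > 0, depending only on d, such that for all p, q ∈ (1,∞) with p < q, setting α = d(1/p − 1/q), one has (1/B₃)·S(p,q) ≤ Ẽ_H(p,q,d) ≤ B₃·S(p,q). -/
open Real

/-- The conjugate exponent `p' = p/(p-1)`. -/
noncomputable def conjExp (p : ℝ) : ℝ := p / (p - 1)

/-- `S(p,q) = min( q^{1/p'}/(p-1), (p')^{1/q}/(q'-1) )`. -/
noncomputable def Sconst (p q : ℝ) : ℝ :=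
  min (q ^ (1 / conjExp p) / (p - 1)) ((conjExp p) ^ (1 / q) / (conjExp q - 1))

/-- The surface measure of the unit sphere in `ℝ^d`: `ω_{d-1} = 2 π^{d/2} / Γ(d/2)`. -/
noncomputable def omegaSphere (d : ℕ) : ℝ :=
  2 * Real.pi ^ ((d : ℝ) / 2) / Real.Gamma ((d : ℝ) / 2)

/-- The best known bound `Ẽ_H(p,q,d)` for the homogeneous Sobolev embedding
constant on `ℝ^d`, with `α = d(1/p - 1/q)`. -/
noncomputable def EHtilde (d : ℕ) (p q : ℝ) : ℝ :=
  let α : ℝ := d * (1 / p - 1 / q)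
  (2 * Real.pi) ^ (-α) * (Real.Gamma (((d : ℝ) - α) / 2) / Real.Gamma (α / 2)) *
    ((d : ℝ) / α) * (omegaSphere d / d) ^ (1 - α / d) * (1 - α / d) ^ (1 - α / d) *
    (p * conjExp q)⁻¹ *
    ((conjExp p) ^ (1 / conjExp p + 1 / q) + q ^ (1 / conjExp p + 1 / q))

theorem ContinuousOn.exists_pos_bounds_Icc {f : ℝ → ℝ} (hf : ContinuousOn f (Set.Icc 0 1))
    (hpos : ∀ x ∈ Set.Icc (0 : ℝ) 1, 0 < f x) :
    ∃ c C : ℝ, 0 < c ∧ 0 < C ∧ ∀ x ∈ Set.Icc (0 : ℝ) 1, c ≤ f x ∧ f x ≤ C := by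
  have hne : (Set.Icc (0 : ℝ) 1).Nonempty := ⟨0, by simp⟩
  obtain ⟨x, hx, hmin⟩ := isCompact_Icc.exists_isMinOn hne hf
  obtain ⟨y, hy, hmax⟩ := isCompact_Icc.exists_isMaxOn hne hf
  exact ⟨f x, f y, hpos x hx, hpos y hy, fun z hz => ⟨hmin hz, hmax hz⟩⟩

/-- The factor of `EHtilde` depending only on `s = 1/p' + 1/q`, multiplied by `s` and written
in a form continuous on `[0, 1]`. -/
noncomputable def sobolevFactor (d : ℕ) (s : ℝ) : ℝ :=
  (2 * π) ^ (-(d * (1 - s))) * (Gamma (d * s / 2 + 1) / Gamma (d * (1 - s) / 2 + 1)) *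
    (omegaSphere d / d) ^ s * exp (s * log s)

theorem omegaSphere_pos {d : ℕ} (hd : 1 ≤ d) : 0 < omegaSphere d := by
  have hd' : (0 : ℝ) < d := by exact_mod_cast hd
  have := Gamma_pos_of_pos (half_pos hd')
  unfold omegaSphere
  positivity

theorem sobolevFactor_pos {d : ℕ} (hd : 1 ≤ d) {s : ℝ} (hs : s ∈ Set.Icc (0 : ℝ) 1) :
    0 < sobolevFactor d s := by
  have hd' : (0 : ℝ) < d := by exact_mod_cast hd
  have h0 := hs.1
  have h1 : 0 ≤ 1 - s := sub_nonneg.2 hs.2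
  have hω := omegaSphere_pos hd
  have hΓ₁ : 0 < Gamma (d * s / 2 + 1) := Gamma_pos_of_pos (by positivity)
  have hΓ₂ : 0 < Gamma (d * (1 - s) / 2 + 1) := Gamma_pos_of_pos (by positivity)
  unfold sobolevFactor
  positivity

theorem Real.continuousAt_Gamma_of_pos {x : ℝ} (hx : 0 < x) : ContinuousAt Gamma x :=
  (differentiableAt_Gamma fun m h => by
    have : (0 : ℝ) ≤ m := m.cast_nonneg
    linarith).continuousAt

theorem continuousOn_sobolevFactor {d : ℕ} (hd : 1 ≤ d) :
    ContinuousOn (sobolevFactor d) (Set.Icc 0 1) := by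
  have hd' : (0 : ℝ) < d := by exact_mod_cast hd
  have hω : 0 < omegaSphere d / d := div_pos (omegaSphere_pos hd) hd'
  intro s hs
  have h0 := hs.1
  have h1 : 0 ≤ 1 - s := sub_nonneg.2 hs.2
  have hx : 0 < d * s / 2 + 1 := by positivity
  have hy : 0 < d * (1 - s) / 2 + 1 := by positivity
  have hΓ₁ : ContinuousAt (fun s : ℝ => Gamma (d * s / 2 + 1)) s :=
    ContinuousAt.comp (f := fun s : ℝ => d * s / 2 + 1) (continuousAt_Gamma_of_pos hx)
      (by fun_prop)
  have hΓ₂ : ContinuousAt (fun s : ℝ => Gamma (d * (1 - s) / 2 + 1)) s :=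
    ContinuousAt.comp (f := fun s : ℝ => d * (1 - s) / 2 + 1) (continuousAt_Gamma_of_pos hy)
      (by fun_prop)
  have hπ : ContinuousAt (fun s : ℝ => (2 * π) ^ (-(d * (1 - s)))) s :=
    ContinuousAt.rpow (by fun_prop) (by fun_prop) (Or.inl (by positivity))
  have hωs : ContinuousAt (fun s : ℝ => (omegaSphere d / d) ^ s) s :=
    ContinuousAt.rpow (by fun_prop) (by fun_prop) (Or.inl hω.ne')
  have hexp : ContinuousAt (fun s : ℝ => exp (s * log s)) s :=
    (continuous_exp.comp continuous_mul_log).continuousAt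
  exact (((hπ.mul (hΓ₁.div hΓ₂ (Gamma_pos_of_pos hy).ne')).mul hωs).mul hexp).continuousWithinAt

/-- `EHtilde` without its bounded factor, in terms of `u = 1/p'` and `v = 1/q`. -/
noncomputable def sobolevProfile (u v : ℝ) : ℝ :=
  (1 - u) * (1 - v) / (u + v) * (u ^ (-(u + v)) + v ^ (-(u + v)))

theorem sobolevProfile_comm (u v : ℝ) : sobolevProfile u v = sobolevProfile v u := by
  unfold sobolevProfile
  rw [add_comm v u]
  ring

theorem one_div_conjExp {p : ℝ} (hp : 1 < p) : 1 / conjExp p = 1 - 1 / p := by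
  unfold conjExp
  have : p ≠ 0 := by positivity
  field_simp

theorem EHtilde_eq {d : ℕ} (hd : 1 ≤ d) {p q : ℝ} (hp : 1 < p) (hq : 1 < q) (hpq : p < q) :
    EHtilde d p q =
      sobolevFactor d (1 / conjExp p + 1 / q) * sobolevProfile (1 / conjExp p) (1 / q) := by
  have hd' : (0 : ℝ) < d := by exact_mod_cast hd
  have hu : 0 < 1 / conjExp p := by
    rw [one_div_conjExp hp, sub_pos, div_lt_one] <;> linarith
  have hv : 0 < 1 / q := by positivity
  have hq' := one_div_conjExp hq
  have hp' := one_div_conjExp hp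
  have ht : 0 < 1 / p - 1 / q := sub_pos.2 (one_div_lt_one_div_of_lt (by linarith) hpq)
  have hcp : conjExp p = (1 / conjExp p)⁻¹ := by simp
  have hqq : q = (1 / q)⁻¹ := by simp
  have hprod : (p * conjExp q)⁻¹ = (1 - 1 / conjExp p) * (1 - 1 / q) := by
    rw [mul_inv, ← one_div, ← one_div, hq', hp']
    ring
  have htuv : 1 / p - 1 / q = 1 - (1 / conjExp p + 1 / q) := by rw [hp']; ring
  have hpow₁ : conjExp p ^ (1 / conjExp p + 1 / q) =
      (1 / conjExp p) ^ (-(1 / conjExp p + 1 / q)) := by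
    rw [rpow_neg hu.le, ← inv_rpow hu.le, ← hcp]
  have hpow₂ : q ^ (1 / conjExp p + 1 / q) = (1 / q) ^ (-(1 / conjExp p + 1 / q)) := by
    rw [rpow_neg hv.le, ← inv_rpow hv.le, ← hqq]
  unfold EHtilde
  simp only
  rw [hprod, hpow₁, hpow₂, htuv]
  rw [htuv] at ht
  generalize 1 / conjExp p = u at *
  generalize 1 / q = v at *
  clear hp' hq' hprod hpow₁ hpow₂ hcp hqq htuv
  unfold sobolevFactor sobolevProfile
  have hs : 0 < u + v := add_pos hu hv
  generalize (u ^ (-(u + v)) + v ^ (-(u + v))) = P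
  generalize u + v = s at *
  have e1 : 1 - d * (1 - s) / d = s := by field_simp; ring
  have e2 : ((d : ℝ) - d * (1 - s)) / 2 = d * s / 2 := by ring
  have e3 : s ^ s = exp (s * log s) := by rw [rpow_def_of_pos hs, mul_comm]
  have hΓ := (Gamma_pos_of_pos (show 0 < (d : ℝ) * (1 - s) / 2 by positivity)).ne'
  rw [e1, e2, e3, Gamma_add_one (by positivity), Gamma_add_one (by positivity)]
  field_simp

theorem Sconst_eq {p q : ℝ} (hp : 1 < p) (hq : 1 < q) :
    Sconst p q = min ((1 / q) ^ (-(1 / conjExp p)) * (1 - 1 / conjExp p) / (1 / conjExp p))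
      ((1 / conjExp p) ^ (-(1 / q)) * (1 - 1 / q) / (1 / q)) := by
  have hp1 : 0 < p - 1 := sub_pos.2 hp
  have hq1 : 0 < q - 1 := sub_pos.2 hq
  have hcp : 0 < conjExp p := div_pos (by linarith) hp1
  have h₁ : (1 / q) ^ (-(1 / conjExp p)) = q ^ (1 / conjExp p) := by
    rw [one_div q, inv_rpow (by linarith), rpow_neg (by linarith), inv_inv]
  have h₂ : (1 / conjExp p) ^ (-(1 / q)) = conjExp p ^ (1 / q) := by
    rw [one_div (conjExp p), inv_rpow hcp.le, rpow_neg hcp.le, inv_inv]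
  have h₃ : (1 - 1 / conjExp p) / (1 / conjExp p) = 1 / (p - 1) := by
    unfold conjExp
    field_simp
    ring
  have h₄ : (1 - 1 / q) / (1 / q) = 1 / (conjExp q - 1) := by
    unfold conjExp
    have : q / (q - 1) - 1 = 1 / (q - 1) := by field_simp; ring
    rw [this]
    field_simp
  rw [h₁, h₂, mul_div_assoc, mul_div_assoc, h₃, h₄, mul_one_div, mul_one_div, Sconst]

theorem Real.rpow_neg_self_le_three {x : ℝ} (hx : 0 < x) : x ^ (-x) ≤ 3 := by
  rw [rpow_def_of_pos hx]
  have h : log x * -x ≤ 1 := by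
    have := one_sub_inv_le_log_of_pos hx
    have h2 : x * (1 - x⁻¹) ≤ x * log x := mul_le_mul_of_nonneg_left this hx.le
    have h3 : x * (1 - x⁻¹) = x - 1 := by field_simp
    linarith
  exact (exp_le_exp.2 h).trans (exp_one_lt_d9.le.trans (by norm_num))

theorem sobolevProfile_comparable_of_le {u v : ℝ} (hu : 0 < u) (huv : u ≤ v) (hs : u + v < 1) :
    min (v ^ (-u) * (1 - u) / u) (u ^ (-v) * (1 - v) / v) ≤ 4 * sobolevProfile u v ∧
      sobolevProfile u v ≤
        36 * min (v ^ (-u) * (1 - u) / u) (u ^ (-v) * (1 - v) / v) := by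
  have hv : 0 < v := hu.trans_le huv
  have hv1 : 0 < 1 - v := by linarith
  have hu1 : 1 / 2 ≤ 1 - u := by linarith
  have hA : 1 ≤ u ^ (-v) := one_le_rpow_of_pos_of_le_one_of_nonpos hu (by linarith) (by linarith)
  have hA' : 1 ≤ u ^ (-u) := one_le_rpow_of_pos_of_le_one_of_nonpos hu (by linarith) (by linarith)
  have hB : 1 ≤ v ^ (-u) := one_le_rpow_of_pos_of_le_one_of_nonpos hv (by linarith) (by linarith)
  have hsplit : u ^ (-(u + v)) = u ^ (-u) * u ^ (-v) := by rw [← rpow_add hu]; ring_nf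
  have hvs : v ^ (-(u + v)) ≤ u ^ (-(u + v)) := rpow_le_rpow_of_nonpos hu huv (by linarith)
  have hvs0 : 0 < v ^ (-(u + v)) := by positivity
  have h3 := rpow_neg_self_le_three hu
  set T := u ^ (-v) * (1 - v) / v with hT
  have hT0 : 0 < T := by positivity
  have hlower : T ≤ 4 * sobolevProfile u v := by
    have h : u ^ (-v) ≤ u ^ (-(u + v)) + v ^ (-(u + v)) := by rw [hsplit]; nlinarith
    calc T = 4 * ((1 / 2) * (1 - v) / (2 * v) * u ^ (-v)) := by rw [hT]; field_simp; norm_num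
      _ ≤ 4 * sobolevProfile u v := by
        unfold sobolevProfile
        gcongr
        linarith
  have hupper : sobolevProfile u v ≤ 6 * T := by
    have h : u ^ (-(u + v)) + v ^ (-(u + v)) ≤ 6 * u ^ (-v) := by nlinarith
    calc sobolevProfile u v ≤ 1 * (1 - v) / v * (6 * u ^ (-v)) := by
          unfold sobolevProfile
          gcongr <;> linarith
      _ = 6 * T := by rw [hT]; ring
  have hfirst : T ≤ 6 * (v ^ (-u) * (1 - u) / u) := by
    have h₁ : u * u ^ (-v) ≤ 3 * v := by
      have e : ∀ x : ℝ, 0 < x → x * x ^ (-v) = x ^ (1 - v) := fun x hx => by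
        rw [sub_eq_add_neg, rpow_add hx, rpow_one]
      have := rpow_le_rpow hu.le huv hv1.le
      rw [← e u hu, ← e v hv] at this
      nlinarith [rpow_neg_self_le_three hv]
    have h₂ : T ≤ 3 / u := by
      rw [hT, div_le_div_iff₀ hv hu]
      nlinarith [mul_pos hu (zero_lt_one.trans_le hA)]
    calc T ≤ 3 / u := h₂
      _ = 6 * (1 * (1 / 2) / u) := by ring
      _ ≤ _ := by gcongr
  refine ⟨(min_le_right _ _).trans hlower, hupper.trans ?_⟩
  have : T / 6 ≤ min (v ^ (-u) * (1 - u) / u) T := le_min (by linarith) (by linarith)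
  linarith

theorem sobolevProfile_comparable {u v : ℝ} (hu : 0 < u) (hv : 0 < v) (hs : u + v < 1) :
    min (v ^ (-u) * (1 - u) / u) (u ^ (-v) * (1 - v) / v) ≤ 4 * sobolevProfile u v ∧
      sobolevProfile u v ≤
        36 * min (v ^ (-u) * (1 - u) / u) (u ^ (-v) * (1 - v) / v) := by
  rcases le_total u v with h | h
  · exact sobolevProfile_comparable_of_le hu h hs
  · rw [min_comm, sobolevProfile_comm]
    exact sobolevProfile_comparable_of_le hv h (by linarith)

/-- For every `d ≥ 1` there is `B₃ > 0`, depending only on `d`, such that for all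
`p, q ∈ (1,∞)` with `p < q`, one has `(1/B₃)·S(p,q) ≤ Ẽ_H(p,q,d) ≤ B₃·S(p,q)`. -/
theorem sobolev_SH_comparable (d : ℕ) (hd : 1 ≤ d) :
    ∃ B₃ : ℝ, 0 < B₃ ∧ ∀ p q : ℝ, 1 < p → 1 < q → p < q →
      (1 / B₃) * Sconst p q ≤ EHtilde d p q ∧ EHtilde d p q ≤ B₃ * Sconst p q := by
  obtain ⟨c, C, hc, hC, hK⟩ := (continuousOn_sobolevFactor hd).exists_pos_bounds_Icc
    fun _ => sobolevFactor_pos hd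
  refine ⟨4 / c + 36 * C, by positivity, fun p q hp hq hpq => ?_⟩
  have hu : 0 < 1 / conjExp p := by
    rw [one_div_conjExp hp, sub_pos, div_lt_one] <;> linarith
  have hv : 0 < 1 / q := by positivity
  have hs : 1 / conjExp p + 1 / q < 1 := by
    have := one_div_lt_one_div_of_lt (by linarith) hpq
    rw [one_div_conjExp hp]
    linarith
  rw [EHtilde_eq hd hp hq hpq]
  obtain ⟨hlower, hupper⟩ := sobolevProfile_comparable hu hv hs
  rw [← Sconst_eq hp hq] at hlower hupper
  obtain ⟨hcK, hKC⟩ := hK _ ⟨(add_pos hu hv).le, hs.le⟩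
  generalize sobolevFactor d (1 / conjExp p + 1 / q) = K at *
  generalize sobolevProfile (1 / conjExp p) (1 / q) = F at *
  generalize Sconst p q = M at *
  have hM : 0 ≤ M := by linarith
  have hF : 0 ≤ F := by linarith
  constructor
  · rw [one_div_mul_eq_div, div_le_iff₀ (by positivity)]
    have h : c * F ≤ K * F := mul_le_mul_of_nonneg_right hcK hF
    calc M ≤ 4 * F := hlower
      _ = c * F * (4 / c) := by field_simp
      _ ≤ K * F * (4 / c) := by gcongr
      _ ≤ K * F * (4 / c + 36 * C) := by
        have : 0 ≤ K * F := (by positivity : 0 ≤ c * F).trans h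
        gcongr
        linarith
  · calc K * F ≤ C * (36 * M) := by gcongr
      _ = 36 * C * M := by ring
      _ ≤ (4 / c + 36 * C) * M := by
        gcongr
        linarith [show 0 < 4 / c by positivity]
end

section
/- For all p, q ∈ (1,∞) with p ≤ q, one has F(p,q) ≥ (1/4)·S(p,q). -/
open Real

/-- `F(p,q) = (1/p' + 1/q)⁻¹ · (p q')⁻¹ · ( (p')^{1/q} + q^{1/p'} )`. -/
noncomputable def Fconst (p q : ℝ) : ℝ :=
  (1 / conjExp p + 1 / q)⁻¹ * (p * conjExp q)⁻¹ *
    ((conjExp p) ^ (1 / q) + q ^ (1 / conjExp p))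

/-- The bound behind `F_ge_quarter_S`, in terms of the reciprocals `a = 1/p'` and `b = 1/q`. -/
theorem quarter_mul_le_of_le_of_add_le_one {a b A B : ℝ} (ha : 0 < a) (hab : a ≤ b)
    (hsum : a + b ≤ 1) (hA : 0 < A) (hB : 0 < B) :
    (1 / 4) * (A * ((1 - b) / b)) ≤ (a + b)⁻¹ * ((1 - a) * (1 - b)) * (A + B) := by
  have hb : 0 < b := ha.trans_le hab
  have hb1 : 0 ≤ 1 - b := by linarith
  have hinv : (4 * b)⁻¹ ≤ (a + b)⁻¹ * (1 - a) := by
    rw [inv_mul_eq_div, inv_eq_one_div, div_le_div_iff₀ (by positivity) (by positivity)]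
    nlinarith
  calc (1 / 4) * (A * ((1 - b) / b)) = (4 * b)⁻¹ * (1 - b) * A := by field_simp
    _ ≤ (a + b)⁻¹ * (1 - a) * (1 - b) * (A + B) := by
      gcongr
      · exact mul_nonneg ((by positivity : (0 : ℝ) ≤ (4 * b)⁻¹).trans hinv) hb1
      · linarith
    _ = (a + b)⁻¹ * ((1 - a) * (1 - b)) * (A + B) := by ring

/-- For all `p, q ∈ (1,∞)` with `p ≤ q`, one has `F(p,q) ≥ (1/4)·S(p,q)`. -/
theorem F_ge_quarter_S (p q : ℝ) (hp : 1 < p) (hq : 1 < q) (hpq : p ≤ q) :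
    (1 / 4) * Sconst p q ≤ Fconst p q := by
  have hp1 : 0 < p - 1 := sub_pos.2 hp
  have hq1 : 0 < q - 1 := sub_pos.2 hq
  have hp0 : 0 < p := by linarith
  have hq0 : 0 < q := by linarith
  have hconj : 0 < conjExp p := div_pos hp0 hp1
  have ha : 1 / conjExp p = 1 - 1 / p := by
    unfold conjExp
    field_simp
  have hpq' : 1 / q ≤ 1 / p := one_div_le_one_div_of_le hp0 hpq
  have hsum : 1 / conjExp p + 1 / q ≤ 1 := by linarith
  have hcoef : (p * conjExp q)⁻¹ = (1 - 1 / conjExp p) * (1 - 1 / q) := by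
    rw [ha]
    unfold conjExp
    field_simp
    ring
  have hS₁ : (p - 1)⁻¹ = (1 - 1 / conjExp p) / (1 / conjExp p) := by
    unfold conjExp
    field_simp
    ring
  have hS₂ : (conjExp q - 1)⁻¹ = (1 - 1 / q) / (1 / q) := by
    have : conjExp q - 1 = (q - 1)⁻¹ := by
      unfold conjExp
      field_simp
      ring
    rw [this]
    field_simp
  have hA : 0 < conjExp p ^ (1 / q) := rpow_pos_of_pos hconj _
  have hB : 0 < q ^ (1 / conjExp p) := rpow_pos_of_pos hq0 _
  unfold Sconst Fconst
  rw [div_eq_mul_inv _ (p - 1), div_eq_mul_inv _ (conjExp q - 1), hS₁, hS₂, hcoef]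
  rcases le_total (1 / conjExp p) (1 / q) with h | h
  · refine (mul_le_mul_of_nonneg_left (min_le_right _ _) (by norm_num)).trans ?_
    exact quarter_mul_le_of_le_of_add_le_one (one_div_pos.2 hconj) h hsum hA hB
  · refine (mul_le_mul_of_nonneg_left (min_le_left _ _) (by norm_num)).trans ?_
    rw [add_comm (1 / conjExp p), mul_comm (1 - 1 / conjExp p),
      add_comm (conjExp p ^ (1 / q))]
    exact quarter_mul_le_of_le_of_add_le_one (one_div_pos.2 hq0) h
      (by linarith) hB hA
end

section
/- For all p, q ∈ (1,∞) with p ≤ q and q ≥ p', one has (1/4)·Q(p,q) ≤ F(p,q) ≤ 2·Q(p,q). -/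
open Real

/-- `Q(p,q) = q^{1/p'}/(p-1)`. -/
noncomputable def Qconst (p q : ℝ) : ℝ := q ^ (1 / conjExp p) / (p - 1)

lemma conjExp_pos {p : ℝ} (hp : 1 < p) : 0 < conjExp p :=
  div_pos (by linarith) (by linarith)

/-- The prefactor of `Fconst` simplified: `(1/p' + 1/q)⁻¹ (p q')⁻¹ = (q-1) / ((p' + q)(p-1))`. -/
lemma Fconst_prefactor_eq {p q : ℝ} (hp : 1 < p) (hq : 1 < q) :
    (1 / conjExp p + 1 / q)⁻¹ * (p * conjExp q)⁻¹ = (q - 1) / (conjExp p + q) / (p - 1) := by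
  have hp0 : p ≠ 0 := by linarith
  have hq0 : q ≠ 0 := by linarith
  have hp1 : p - 1 ≠ 0 := by linarith
  have hq1 : q - 1 ≠ 0 := by linarith
  have hs : p + q * (p - 1) ≠ 0 := by nlinarith
  have h₁ : 1 / conjExp p + 1 / q = (p + q * (p - 1)) / (p * q) := by
    unfold conjExp; field_simp; ring
  have h₂ : conjExp p + q = (p + q * (p - 1)) / (p - 1) := by
    unfold conjExp; field_simp
  rw [h₁, h₂]
  unfold conjExp
  field_simp

lemma two_le_of_conjExp_le {p q : ℝ} (hp : 1 < p) (hpq : p ≤ q) (hqp' : conjExp p ≤ q) :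
    2 ≤ q := by
  have h : p ≤ q * (p - 1) := (div_le_iff₀ (by linarith)).1 hqp'
  by_contra! hq
  nlinarith

lemma conjExp_rpow_le {p q : ℝ} (hp : 1 < p) (hq : 1 < q) (hqp' : conjExp p ≤ q) :
    conjExp p ^ (1 / q) ≤ q ^ (1 / conjExp p) :=
  calc conjExp p ^ (1 / q) ≤ q ^ (1 / q) :=
        rpow_le_rpow (conjExp_pos hp).le hqp' (by positivity)
    _ ≤ q ^ (1 / conjExp p) :=
        rpow_le_rpow_of_exponent_le hq.le (one_div_le_one_div_of_le (conjExp_pos hp) hqp')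

/-- For all `p, q ∈ (1,∞)` with `p ≤ q` and `q ≥ p'`,
one has `(1/4)·Q(p,q) ≤ F(p,q) ≤ 2·Q(p,q)`. -/
theorem F_comparable_Q (p q : ℝ) (hp : 1 < p) (hq : 1 < q) (hpq : p ≤ q)
    (hqp' : conjExp p ≤ q) :
    (1 / 4) * Qconst p q ≤ Fconst p q ∧ Fconst p q ≤ 2 * Qconst p q := by
  have hP := conjExp_pos hp
  have hq2 := two_le_of_conjExp_le hp hpq hqp'
  have hX : 0 ≤ conjExp p ^ (1 / q) := rpow_nonneg hP.le _
  have hXY := conjExp_rpow_le hp hq hqp'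
  have hlow : 1 / 4 ≤ (q - 1) / (conjExp p + q) := by
    rw [le_div_iff₀ (by linarith)]; linarith
  have hupp : (q - 1) / (conjExp p + q) ≤ 1 := by
    rw [div_le_one (by linarith)]; linarith
  have hp1 : 0 ≤ p - 1 := by linarith
  rw [Fconst, Qconst, Fconst_prefactor_eq hp hq, div_mul_eq_mul_div _ (p - 1),
    ← mul_div_assoc, ← mul_div_assoc]
  constructor <;> refine div_le_div_of_nonneg_right ?_ hp1 <;> nlinarith
end

section
/- For all p, q ∈ (1,∞) with p ≤ q and q ≥ p', one has q^{1/p'}/(p−1) ≤ (p')^{1/q}/(q'−1); that is, Q(p,q) ≤ Q(q',p'). -/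
open Real

/-- Logarithmic form of the comparison, in terms of the exponents `r = p'` and `q`. -/
lemma log_div_add_log_sub_one_le {r q : ℝ} (hr : 1 < r) (hrq : r ≤ q) :
    log q / r + log (r - 1) ≤ log r / q + log (q - 1) := by
  have hr0 : 0 < r := by linarith
  have hq0 : 0 < q := by linarith
  have hmono : log (q * (r - 1)) ≤ log (r * (q - 1)) :=
    log_le_log (mul_pos hq0 (by linarith)) (by linarith)
  rw [log_mul hq0.ne' (by linarith), log_mul hr0.ne' (by linarith)] at hmono
  have hlog : 1 - r / q ≤ log q - log r := by
    have h := log_le_sub_one_of_pos (div_pos hr0 hq0)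
    rw [log_div hr0.ne' hq0.ne'] at h
    linarith
  have hlogr : log r ≤ r - 1 := log_le_sub_one_of_pos hr0
  have hinv : 1 / q ≤ 1 / r := one_div_le_one_div_of_le hr0 hrq
  have hinv1 : 1 / r ≤ 1 := by rw [div_le_one hr0]; exact hr.le
  have h1 := mul_le_mul_of_nonneg_left hlog (sub_nonneg.2 hinv1)
  have h2 := mul_le_mul_of_nonneg_left hlogr (sub_nonneg.2 hinv)
  have h3 : (1 - 1 / r) * (1 - r / q) = (1 / r - 1 / q) * (r - 1) := by
    field_simp
  have h4 : log q / r = 1 / r * log q := by ring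
  have h5 : log r / q = 1 / q * log r := by ring
  rw [h4, h5]
  linarith

lemma rpow_one_div_mul_sub_one_le {r q : ℝ} (hr : 1 < r) (hrq : r ≤ q) :
    q ^ (1 / r) * (r - 1) ≤ r ^ (1 / q) * (q - 1) := by
  have hr0 : 0 < r := by linarith
  have hq0 : 0 < q := by linarith
  have hr1 : 0 < r - 1 := by linarith
  have hq1 : 0 < q - 1 := by linarith
  have hqr := rpow_pos_of_pos hq0 (1 / r)
  have hrq' := rpow_pos_of_pos hr0 (1 / q)
  rw [← log_le_log_iff (mul_pos hqr hr1) (mul_pos hrq' hq1), log_mul hqr.ne' hr1.ne',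
    log_mul hrq'.ne' hq1.ne', log_rpow hq0, log_rpow hr0, one_div_mul_eq_div,
    one_div_mul_eq_div]
  exact log_div_add_log_sub_one_le hr hrq

lemma conjExp_sub_one {p : ℝ} (hp : 1 < p) : conjExp p - 1 = (p - 1)⁻¹ := by
  have h : p - 1 ≠ 0 := by linarith
  rw [conjExp]
  field_simp
  ring

/-- For all `p, q ∈ (1,∞)` with `p ≤ q` and `q ≥ p'`, one has
`q^{1/p'}/(p-1) ≤ (p')^{1/q}/(q'-1)`, i.e. `Q(p,q) ≤ Q(q',p')`. -/
theorem Q_comparison (p q : ℝ) (hp : 1 < p) (hq : 1 < q) (hpq : p ≤ q)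
    (hqp' : conjExp p ≤ q) :
    q ^ (1 / conjExp p) / (p - 1) ≤ (conjExp p) ^ (1 / q) / (conjExp q - 1) := by
  have hr : 1 < conjExp p := by
    have h := inv_pos.2 (sub_pos.2 hp)
    rw [← conjExp_sub_one hp] at h
    linarith
  have h := rpow_one_div_mul_sub_one_le hr hqp'
  rw [conjExp_sub_one hp] at h
  rwa [conjExp_sub_one hq, div_inv_eq_mul, div_eq_mul_inv]
end

section
/- The function x ↦ x^{x/(x−1)} is monotonically increasing on (1,∞); equivalently, for all real a, b with 1 < a ≤ b, one has a^{a/(a−1)} ≤ b^{b/(b−1)}. -/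
open Real

/-- The function `x ↦ x^{x/(x-1)}` is monotonically increasing on `(1,∞)`:
for all real `a, b` with `1 < a ≤ b`, one has `a^{a/(a-1)} ≤ b^{b/(b-1)}`. -/
theorem rpow_self_div_sub_one_mono (a b : ℝ) (ha : 1 < a) (hab : a ≤ b) :
    a ^ (a / (a - 1)) ≤ b ^ (b / (b - 1)) := by
  have hb : 1 < b := ha.trans_le hab
  have ha₀ : 0 < a := by linarith
  have hb₀ : 0 < b := by linarith
  rw [rpow_def_of_pos ha₀, rpow_def_of_pos hb₀, exp_le_exp]
  have secant := convexOn_mul_log.secant_mono (a := 1) (Set.mem_Ici.2 zero_le_one)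
    (Set.mem_Ici.2 ha₀.le) (Set.mem_Ici.2 hb₀.le) ha.ne' hb.ne' hab
  simp only [log_one, mul_zero, sub_zero] at secant
  calc log a * (a / (a - 1)) = a * log a / (a - 1) := by ring
    _ ≤ b * log b / (b - 1) := secant
    _ = log b * (b / (b - 1)) := by ring
end

section
/- Let d ≥ 1 be an integer. There exists a constant C > 0, depending only on d, with the following property. Let p, q ∈ (1,∞) with p < q, set α = d(1/p − 1/q) (so 0 < α < d), and define: q₁ = (1 − α/d)^{−1}; p₂ = (α/d + 1/(q+1))^{−1}; q₂ = q+1; θ = (1 − 1/p)/(1 − α/d − 1/(q+1)); M₁ = α^{−(1−α/d)}; M₂ = (d^{α/d}/α) · (α/d)^{ (α/d)/(α/d + 1/(q+1)) } · [ (1 − α/d − 1/(q+1))·(q+1) ]^{ 1/(1 + d/(α(q+1))) − α/d }; M₀ = q·(p₂/p)^{q₂/p₂}/(q₂ − q) + q·p^{−q₁}/(q − q₁). Then M₀^{1/q} · M₁^{1−θ} · M₂^{θ} ≤ C · ((d−α)/α) · p' · q^{1−1/p}. -/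
open Real

/-- The interpolation factor is at most `(12 * ((1 - a) * (p / (p - 1)))) ^ q`, where
`a = 1 / p - 1 / q`. -/
lemma interpolation_factor_le {p q a e : ℝ} (hp : 1 < p) (hq : 1 < q) (ha : 0 < a)
    (hap : a = 1 / p - 1 / q) (he : e = 1 / (q + 1)) :
    q * ((a + e)⁻¹ / p) ^ ((q + 1) / (a + e)⁻¹) / (q + 1 - q) +
        q * p ^ (-(1 - a)⁻¹) / (q - (1 - a)⁻¹) ≤
      (12 * ((1 - a) * (p / (p - 1)))) ^ q := by
  have hp1 : 0 < p - 1 := by linarith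
  have he0 : 0 < e := by rw [he]; positivity
  have h1a : 1 - a = 1 / q + (p - 1) / p := by rw [hap]; field_simp; ring
  have h1a0 : 0 < 1 - a := by rw [h1a]; positivity
  have hT : (1 - a) * (p / (p - 1)) = 1 + p / (p - 1) / q := by rw [h1a]; field_simp; ring
  have hT1 : 1 ≤ (1 - a) * (p / (p - 1)) := by
    rw [hT]
    have : 0 < p / (p - 1) / q := by positivity
    linarith
  set T := (1 - a) * (p / (p - 1)) with hTdef
  have hbase : (a + e)⁻¹ / p ≤ exp ((1 / q - e) / (a + e)) := by
    have h : (a + e)⁻¹ / p = (1 / q - e) / (a + e) + 1 := by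
      have : 1 / p = a + 1 / q := by rw [hap]; ring
      rw [show (a + e)⁻¹ / p = (1 / p) / (a + e) by ring, this]
      field_simp
      ring
    rw [h]
    exact add_one_le_exp _
  have hfirst : ((a + e)⁻¹ / p) ^ ((q + 1) / (a + e)⁻¹) ≤ 3 := by
    calc ((a + e)⁻¹ / p) ^ ((q + 1) / (a + e)⁻¹)
        ≤ exp ((1 / q - e) / (a + e)) ^ ((q + 1) / (a + e)⁻¹) :=
          rpow_le_rpow (by positivity) hbase (by positivity)
      _ = exp (1 / q) := by
          rw [← exp_mul, he]
          congr 1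
          have : a + 1 / (q + 1) ≠ 0 := by rw [← he]; positivity
          field_simp
          ring
      _ ≤ exp 1 := exp_le_exp.2 ((div_le_one (by linarith)).2 hq.le)
      _ ≤ 3 := by linarith [exp_one_lt_d9]
  have hsecond : q * p ^ (-(1 - a)⁻¹) / (q - (1 - a)⁻¹) ≤ T := by
    have h : q * p ^ (-(1 - a)⁻¹) / (q - (1 - a)⁻¹) = T * p ^ (-(1 - a)⁻¹) := by
      have hk : q - (1 - a)⁻¹ = q * ((p - 1) / p) / (1 - a) := by
        have : (p - 1) / p = (1 - a) - 1 / q := by rw [h1a]; ring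
        rw [this]
        field_simp
      rw [hk, hTdef]
      field_simp
    rw [h]
    have : p ^ (-(1 - a)⁻¹) ≤ 1 :=
      rpow_le_one_of_one_le_of_nonpos hp.le (by simpa using h1a0.le)
    nlinarith
  have hq3 : q ≤ 3 ^ q := by
    have := add_one_le_exp q
    have h3 : exp q ≤ 3 ^ q := by
      rw [← exp_one_rpow]
      exact rpow_le_rpow (exp_pos _).le (by linarith [exp_one_lt_d9]) (by linarith)
    linarith
  have h4 : (4 : ℝ) ≤ 4 ^ q := self_le_rpow_of_one_le (by norm_num) hq.le
  have hTq : T ≤ T ^ q := self_le_rpow_of_one_le hT1 hq.le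
  calc _ ≤ q * 3 + T := by
        rw [show q + 1 - q = 1 by ring, div_one]
        gcongr
    _ ≤ 4 * q * T := by nlinarith
    _ ≤ 4 ^ q * 3 ^ q * T ^ q := by gcongr
    _ = (12 * T) ^ q := by
        rw [← mul_rpow (by norm_num) (by norm_num), ← mul_rpow (by norm_num) (by linarith)]
        norm_num

/-- The weak-type norms at the two endpoints interpolate to at most `2 * a⁻¹ * q ^ u`. -/
lemma weak_type_norms_interpolation_le {D q a e u θ : ℝ} (hD : 1 ≤ D) (hq : 1 < q) (ha : 0 < a)
    (he : 0 < e) (hu : 0 < u) (hu1 : u ≤ 1) (hv : 0 < 1 - a - e) (hθ : θ = u / (1 - a - e))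
    (hθ1 : θ ≤ 1) :
    ((D * a) ^ (-(1 - a))) ^ (1 - θ) *
        (D ^ a / (D * a) * a ^ (a / (a + e)) *
          ((1 - a - e) * (q + 1)) ^ (a / (a + e) - a)) ^ θ ≤ 2 * a⁻¹ * q ^ u := by
  have hθ0 : 0 < θ := by rw [hθ]; positivity
  have hD0 : 0 < D := by linarith
  have hq0 : 0 < q := by linarith
  have hM1 : (D * a) ^ (-(1 - a)) ≤ a⁻¹ := by
    rw [mul_rpow hD0.le ha.le, ← rpow_neg_one a]
    have h1 : D ^ (-(1 - a)) ≤ 1 := rpow_le_one_of_one_le_of_nonpos hD (by linarith)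
    have h2 : a ^ (-(1 - a)) ≤ a ^ (-1 : ℝ) :=
      rpow_le_rpow_of_exponent_ge ha (by linarith) (by linarith)
    calc _ ≤ 1 * a ^ (-1 : ℝ) := by gcongr
      _ = _ := one_mul _
  have hM2 : D ^ a / (D * a) * a ^ (a / (a + e)) ≤ a⁻¹ := by
    have h1 : D ^ a ≤ D := by
      simpa using rpow_le_rpow_of_exponent_le hD (show a ≤ 1 by linarith)
    have h2 : a ^ (a / (a + e)) ≤ 1 := rpow_le_one ha.le (by linarith) (by positivity)
    calc _ ≤ D / (D * a) * 1 := by gcongr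
      _ = a⁻¹ := by field_simp
  have hexp : a / (a + e) - a = a * (1 - a - e) / (a + e) := by field_simp; ring
  have hM3 : (((1 - a - e) * (q + 1)) ^ (a / (a + e) - a)) ^ θ ≤ 2 * q ^ u := by
    rw [hexp, ← rpow_mul (by positivity)]
    have h1 : a * (1 - a - e) / (a + e) * θ = a / (a + e) * u := by rw [hθ]; field_simp
    have h2 : a / (a + e) ≤ 1 := (div_le_one (by positivity)).2 (by linarith)
    rw [h1]
    calc _ ≤ (2 * q) ^ (a / (a + e) * u) := by
          apply rpow_le_rpow (by positivity) _ (by positivity)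
          nlinarith
      _ ≤ (2 * q) ^ u := rpow_le_rpow_of_exponent_le (by linarith) (by nlinarith)
      _ = 2 ^ u * q ^ u := mul_rpow (by norm_num) hq0.le
      _ ≤ 2 * q ^ u := by
          gcongr
          simpa using rpow_le_rpow_of_exponent_le (by norm_num : (1 : ℝ) ≤ 2) hu1
  rw [mul_rpow (x := D ^ a / (D * a) * a ^ (a / (a + e))) (by positivity) (by positivity)]
  calc _ ≤ a⁻¹ ^ (1 - θ) * (a⁻¹ ^ θ * (2 * q ^ u)) := by
        have : 0 ≤ 1 - θ := by linarith
        gcongr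
    _ = 2 * a⁻¹ * q ^ u := by
        rw [← mul_assoc, ← rpow_add (by positivity)]
        simp only [sub_add_cancel, rpow_one]
        ring

/-- For every `d ≥ 1` there exists `C > 0`, depending only on `d`, such that for all
`p, q ∈ (1,∞)` with `p < q`, setting `α = d(1/p - 1/q)` and defining the
interpolation endpoint exponents `q₁, p₂, q₂`, the interpolation parameter `θ`,
the weak-type norms `M₁, M₂` and the interpolation factor `M₀` as in the
Marcinkiewicz interpolation argument, one has
`M₀^{1/q} · M₁^{1-θ} · M₂^{θ} ≤ C · ((d-α)/α) · p' · q^{1-1/p}`. -/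
theorem marcinkiewicz_constant_bound (d : ℕ) (hd : 1 ≤ d) :
    ∃ C : ℝ, 0 < C ∧ ∀ p q α q₁ p₂ q₂ θ M₁ M₂ M₀ : ℝ,
      1 < p → 1 < q → p < q →
      α = d * (1 / p - 1 / q) →
      q₁ = (1 - α / d)⁻¹ →
      p₂ = (α / d + 1 / (q + 1))⁻¹ →
      q₂ = q + 1 →
      θ = (1 - 1 / p) / (1 - α / d - 1 / (q + 1)) →
      M₁ = α ^ (-(1 - α / d)) →
      M₂ = ((d : ℝ) ^ (α / d) / α) * (α / d) ^ ((α / d) / (α / d + 1 / (q + 1))) *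
          ((1 - α / d - 1 / (q + 1)) * (q + 1)) ^ (1 / (1 + d / (α * (q + 1))) - α / d) →
      M₀ = q * (p₂ / p) ^ (q₂ / p₂) / (q₂ - q) + q * p ^ (-q₁) / (q - q₁) →
      M₀ ^ (1 / q) * M₁ ^ (1 - θ) * M₂ ^ θ ≤
        C * (((d : ℝ) - α) / α) * (p / (p - 1)) * q ^ (1 - 1 / p) := by
  refine ⟨24, by norm_num, ?_⟩
  rintro p q α q₁ p₂ q₂ θ M₁ M₂ M₀ hp hq hpq hα rfl rfl rfl hθ rfl rfl rfl
  have hD : (1 : ℝ) ≤ d := by exact_mod_cast hd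
  have hD0 : (0 : ℝ) < d := by linarith
  obtain ⟨a, ha⟩ : ∃ a, a = 1 / p - 1 / q := ⟨_, rfl⟩
  obtain ⟨e, he⟩ : ∃ e, e = 1 / (q + 1) := ⟨_, rfl⟩
  have ha0 : 0 < a := by
    rw [ha, sub_pos]
    exact one_div_lt_one_div_of_lt (by linarith) hpq
  have he0 : 0 < e := by rw [he]; positivity
  have heq : e < 1 / q := by
    rw [he]
    exact one_div_lt_one_div_of_lt (by linarith) (by linarith)
  have hp1 : 1 / p < 1 := (div_lt_one (by linarith)).2 hp
  have hp0 : 0 < 1 / p := by positivity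
  have hv : 0 < 1 - a - e := by linarith
  rw [← ha] at hα
  have hαd : α / d = a := by rw [hα]; field_simp
  have hx : 1 / (1 + d / (α * (q + 1))) = a / (a + e) := by
    rw [hα, he]
    field_simp
  rw [hx, hαd, ← he, hα]
  rw [hαd, ← he] at hθ
  have hθ1 : θ ≤ 1 := by
    rw [hθ]
    exact (div_le_one hv).2 (by linarith)
  have hM := weak_type_norms_interpolation_le hD hq ha0 he0 (sub_pos.2 hp1) (by linarith) hv hθ hθ1
  have hM₀ := interpolation_factor_le hp hq ha0 ha he
  have h1a : 0 < 1 - a := by linarith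
  have hp2 : 0 < p - 1 := by linarith
  have hq₁ : 0 ≤ q - (1 - a)⁻¹ := by
    rw [sub_nonneg, inv_le_comm₀ h1a (by linarith), ← one_div]
    linarith
  have hroot := rpow_le_rpow (z := 1 / q)
    (add_nonneg (div_nonneg (by positivity) (by linarith)) (div_nonneg (by positivity) hq₁))
    hM₀ (by positivity)
  rw [← rpow_mul (by positivity), mul_one_div_cancel (by linarith), rpow_one] at hroot
  rw [mul_assoc]
  calc _ ≤ 12 * ((1 - a) * (p / (p - 1))) * (2 * a⁻¹ * q ^ (1 - 1 / p)) :=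
        mul_le_mul hroot hM (by positivity) (by positivity)
    _ = _ := by field_simp; ring
end
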